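/- There exist absolute constants C < ∞ and d ∈ ℕ such that for every finite field F_q the following holds: let X₁, X₂ ∈ F_q be random variables and A₁, A₂ be discrete random variables such that the pairs (X₁, A₁) and (X₂, A₂) are independent of each other. Then 1 − H̄(X₁ + X₂ | A₁, A₂) ≤ C·q^d·(1 − H̄(X₁ | A₁))·(1 − H̄(X₂ | A₂)). -/

import Mathlib

open MeasureTheory ProbabilityTheory Real Finset

/-- The probability mass that the random variable `X` puts on the value `a`. -/
noncomputable def massOf {Ω : Type*} [MeasurableSpace Ω] (μ : Measure Ω)
    {S : Type*} (X : Ω → S) (a : S) : ℝ :=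
  (μ (X ⁻¹' {a})).toReal

/-- Shannon entropy (in bits) of a random variable with values in a finite type. -/
noncomputable def entropy {Ω : Type*} [MeasurableSpace Ω] (μ : Measure Ω)
    {S : Type*} [Fintype S] (X : Ω → S) : ℝ :=
  (∑ a : S, Real.negMulLog (massOf μ X a)) / Real.log 2

/-- Conditional Shannon entropy (in bits) `H(X | Y)`. -/
noncomputable def condEntropy {Ω : Type*} [MeasurableSpace Ω] (μ : Measure Ω)
    {S T : Type*} [Fintype S] [Fintype T] (X : Ω → S) (Y : Ω → T) : ℝ :=
  ∑ b : T, massOf μ Y b * entropy (μ[|Y ⁻¹' {b}]) X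

/-- Normalized (`q`-ary) entropy `H̄(X) = H(X) / log₂ q`. -/
noncomputable def nEntropy {Ω : Type*} [MeasurableSpace Ω] (μ : Measure Ω)
    {S : Type*} [Fintype S] (X : Ω → S) : ℝ :=
  entropy μ X / Real.logb 2 (Fintype.card S)

/-- Normalized conditional entropy `H̄(X|Y) = H(X|Y) / log₂ q`. -/
noncomputable def nCondEntropy {Ω : Type*} [MeasurableSpace Ω] (μ : Measure Ω)
    {S T : Type*} [Fintype S] [Fintype T] (X : Ω → S) (Y : Ω → T) : ℝ :=
  condEntropy μ X Y / Real.logb 2 (Fintype.card S)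

/-- The divergence, in nats, of a mass function on a finite type from the uniform one. -/
noncomputable def uniformGap {S : Type*} [Fintype S] (p : S → ℝ) : ℝ :=
  Real.log (Fintype.card S) - ∑ a, Real.negMulLog (p a)

lemma sq_sub_one_le_mul_log {x q : ℝ} (hx : 0 ≤ x) (hxq : x ≤ q) (hq : 1 ≤ q) :
    (x - 1) ^ 2 ≤ 4 * q * (x * Real.log x - x + 1) := by
  obtain ⟨s, hs, rfl⟩ : ∃ s : ℝ, 0 ≤ s ∧ x = s ^ 2 :=
    ⟨√x, Real.sqrt_nonneg x, (Real.sq_sqrt hx).symm⟩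
  have h1 : (s - 1) ^ 2 ≤ s ^ 2 * Real.log (s ^ 2) - s ^ 2 + 1 := by
    rcases hs.eq_or_lt with rfl | hs'
    · norm_num
    · have h := Real.one_sub_inv_le_log_of_pos hs'
      have h2 : s ^ 2 * (1 - s⁻¹) ≤ s ^ 2 * Real.log s := by gcongr
      have h3 : s ^ 2 * (1 - s⁻¹) = s ^ 2 - s := by field_simp
      rw [Real.log_pow]
      push_cast
      linarith
  have h2 : (s + 1) ^ 2 ≤ 4 * q := by nlinarith [sq_nonneg (s - 1)]
  calc (s ^ 2 - 1) ^ 2 = (s + 1) ^ 2 * (s - 1) ^ 2 := by ring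
    _ ≤ 4 * q * (s ^ 2 * Real.log (s ^ 2) - s ^ 2 + 1) := by gcongr

lemma sum_sub_inv_card_sq {S : Type*} [Fintype S] [Nonempty S] {p : S → ℝ} (h1 : ∑ a, p a = 1) :
    ∑ a, (p a - (Fintype.card S : ℝ)⁻¹) ^ 2 = ∑ a, p a ^ 2 - (Fintype.card S : ℝ)⁻¹ := by
  have hq : (Fintype.card S : ℝ) ≠ 0 := by exact_mod_cast Fintype.card_ne_zero
  simp only [sub_sq, Finset.sum_add_distrib, Finset.sum_sub_distrib, ← Finset.sum_mul,
    ← Finset.mul_sum, h1, Finset.sum_const, Finset.card_univ, nsmul_eq_mul]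
  field_simp
  ring

lemma uniformGap_eq_sum {S : Type*} [Fintype S] [Nonempty S] {p : S → ℝ} (h1 : ∑ a, p a = 1) :
    uniformGap p = ∑ a, p a * Real.log (Fintype.card S * p a) := by
  have hq : (Fintype.card S : ℝ) ≠ 0 := by exact_mod_cast Fintype.card_ne_zero
  have h : ∀ a, p a * Real.log (Fintype.card S * p a)
      = p a * Real.log (Fintype.card S) - Real.negMulLog (p a) := by
    intro a
    rcases eq_or_ne (p a) 0 with h | h
    · simp [h]
    · rw [Real.log_mul hq h, Real.negMulLog]
      ring
  simp_rw [h]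
  rw [Finset.sum_sub_distrib, ← Finset.sum_mul, h1, one_mul, uniformGap]

lemma uniformGap_le_sum_sq {S : Type*} [Fintype S] [Nonempty S] {p : S → ℝ} (h0 : ∀ a, 0 ≤ p a)
    (h1 : ∑ a, p a = 1) :
    uniformGap p ≤ Fintype.card S * ∑ a, (p a - (Fintype.card S : ℝ)⁻¹) ^ 2 := by
  have hq : (Fintype.card S : ℝ) ≠ 0 := by exact_mod_cast Fintype.card_ne_zero
  have hle : ∀ a, p a * Real.log (Fintype.card S * p a) ≤ Fintype.card S * p a ^ 2 - p a := by
    intro a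
    rcases (h0 a).eq_or_lt with h | h
    · simp [← h]
    · have hl := Real.log_le_sub_one_of_pos (x := Fintype.card S * p a) (by positivity)
      calc p a * Real.log (Fintype.card S * p a) ≤ p a * (Fintype.card S * p a - 1) := by gcongr
        _ = _ := by ring
  rw [uniformGap_eq_sum h1, sum_sub_inv_card_sq h1]
  refine (Finset.sum_le_sum fun a _ => hle a).trans_eq ?_
  rw [Finset.sum_sub_distrib, h1, ← Finset.mul_sum, mul_sub, mul_inv_cancel₀ hq]

lemma sum_sq_le_uniformGap {S : Type*} [Fintype S] [Nonempty S] {p : S → ℝ} (h0 : ∀ a, 0 ≤ p a)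
    (h1 : ∑ a, p a = 1) :
    ∑ a, (p a - (Fintype.card S : ℝ)⁻¹) ^ 2 ≤ 4 * uniformGap p := by
  have hq1 : (1 : ℝ) ≤ Fintype.card S := by exact_mod_cast Fintype.card_pos
  have hq : (Fintype.card S : ℝ) ≠ 0 := by positivity
  have hle : ∀ a, (p a - (Fintype.card S : ℝ)⁻¹) ^ 2 ≤
      4 * (p a * Real.log (Fintype.card S * p a) - p a + (Fintype.card S : ℝ)⁻¹) := by
    intro a
    have hp1 : p a ≤ 1 := h1 ▸ Finset.single_le_sum (fun b _ => h0 b) (Finset.mem_univ a)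
    have h := sq_sub_one_le_mul_log (x := Fintype.card S * p a) (q := Fintype.card S)
      (mul_nonneg (by positivity) (h0 a)) (mul_le_of_le_one_right (by positivity) hp1) hq1
    set q : ℝ := (Fintype.card S : ℝ)
    have hq2 : 0 < q ^ 2 := by positivity
    refine le_of_mul_le_mul_left ?_ hq2
    calc q ^ 2 * (p a - q⁻¹) ^ 2 = (q * p a - 1) ^ 2 := by field_simp
      _ ≤ _ := h
      _ = _ := by field_simp
  refine (Finset.sum_le_sum fun a _ => hle a).trans_eq ?_
  rw [← Finset.mul_sum, Finset.sum_add_distrib, Finset.sum_sub_distrib, h1, uniformGap_eq_sum h1]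
  simp [hq]

lemma uniformGap_nonneg {S : Type*} [Fintype S] [Nonempty S] {p : S → ℝ} (h0 : ∀ a, 0 ≤ p a)
    (h1 : ∑ a, p a = 1) : 0 ≤ uniformGap p := by
  have h := (Finset.sum_nonneg fun a _ => sq_nonneg (p a - (Fintype.card S : ℝ)⁻¹)).trans
    (sum_sq_le_uniformGap h0 h1)
  linarith

lemma sum_mul_sub_eq_one {G : Type*} [AddCommGroup G] [Fintype G] {p r : G → ℝ}
    (hp1 : ∑ a, p a = 1) (hr1 : ∑ a, r a = 1) : ∑ z, ∑ x, p x * r (z - x) = 1 := by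
  rw [Finset.sum_comm]
  simp_rw [← Finset.mul_sum]
  have h : ∀ x, ∑ z, r (z - x) = 1 := fun x => by
    rw [← hr1]
    exact (Equiv.subRight x).sum_comp r
  simp [h, hp1]

lemma uniformGap_convolution_le {G : Type*} [AddCommGroup G] [Fintype G] {p r : G → ℝ}
    (hp0 : ∀ a, 0 ≤ p a) (hp1 : ∑ a, p a = 1) (hr0 : ∀ a, 0 ≤ r a) (hr1 : ∑ a, r a = 1) :
    uniformGap (fun z => ∑ x, p x * r (z - x)) ≤
      16 * (Fintype.card G : ℝ) ^ 2 * (uniformGap p * uniformGap r) := by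
  have hP := sum_sq_le_uniformGap hp0 hp1
  have hR := sum_sq_le_uniformGap hr0 hr1
  have hgap := uniformGap_le_sum_sq (p := fun z => ∑ x, p x * r (z - x))
    (fun z => Finset.sum_nonneg fun x _ => mul_nonneg (hp0 x) (hr0 _)) (sum_mul_sub_eq_one hp1 hr1)
  have hp_gap := uniformGap_nonneg hp0 hp1
  have hq : (Fintype.card G : ℝ) ≠ 0 := by exact_mod_cast Fintype.card_ne_zero
  set q : ℝ := (Fintype.card G : ℝ) with hqdef
  have hpoint : ∀ z, (∑ x, p x * r (z - x) - q⁻¹) ^ 2 ≤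
      (∑ a, (p a - q⁻¹) ^ 2) * ∑ a, (r a - q⁻¹) ^ 2 := by
    intro z
    have hr' : ∑ x, r (z - x) = 1 := by
      rw [← hr1]
      exact (Equiv.subLeft z).sum_comp r
    have hr2 : ∑ x, (r (z - x) - q⁻¹) ^ 2 = ∑ a, (r a - q⁻¹) ^ 2 :=
      (Equiv.subLeft z).sum_comp fun a => (r a - q⁻¹) ^ 2
    have heq : ∑ x, p x * r (z - x) - q⁻¹ = ∑ x, (p x - q⁻¹) * (r (z - x) - q⁻¹) := by
      simp only [sub_mul, mul_sub, Finset.sum_sub_distrib, ← Finset.sum_mul, ← Finset.mul_sum,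
        hp1, hr', Finset.sum_const, Finset.card_univ, nsmul_eq_mul, ← hqdef]
      field_simp
      ring
    rw [heq, ← hr2]
    exact Finset.sum_mul_sq_le_sq_mul_sq _ _ _
  calc uniformGap (fun z => ∑ x, p x * r (z - x))
      ≤ q * ∑ z, (∑ x, p x * r (z - x) - q⁻¹) ^ 2 := hgap
    _ ≤ q * ∑ _z : G, ((∑ a, (p a - q⁻¹) ^ 2) * ∑ a, (r a - q⁻¹) ^ 2) := by
        gcongr with z
        exact hpoint z
    _ = q ^ 2 * ((∑ a, (p a - q⁻¹) ^ 2) * ∑ a, (r a - q⁻¹) ^ 2) := by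
        rw [Finset.sum_const, Finset.card_univ, nsmul_eq_mul, ← hqdef]
        ring
    _ ≤ q ^ 2 * ((4 * uniformGap p) * (4 * uniformGap r)) := by
        gcongr
    _ = _ := by ring

section Mass

variable {Ω : Type*} [MeasurableSpace Ω] {μ : Measure Ω}

lemma massOf_nonneg {S : Type*} (X : Ω → S) (a : S) : 0 ≤ massOf μ X a :=
  ENNReal.toReal_nonneg

lemma sum_measureReal_inter_preimage [IsFiniteMeasure μ] {S : Type*} [Fintype S]
    [MeasurableSpace S] [MeasurableSingletonClass S] {X : Ω → S} (hX : Measurable X) (s : Set Ω) :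
    ∑ a, μ.real (s ∩ X ⁻¹' {a}) = μ.real s := by
  have h := sum_measureReal_preimage_singleton (μ := μ.restrict s) (f := X) Finset.univ
    (fun a _ => hX (measurableSet_singleton a))
  simp only [Finset.coe_univ, Set.preimage_univ, measureReal_restrict_apply_univ] at h
  rw [← h]
  refine Finset.sum_congr rfl fun a _ => ?_
  rw [measureReal_restrict_apply (hX (measurableSet_singleton a)), Set.inter_comm]

lemma sum_massOf_eq_one [IsProbabilityMeasure μ] {S : Type*} [Fintype S]
    [MeasurableSpace S] [MeasurableSingletonClass S] {X : Ω → S} (hX : Measurable X) :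
    ∑ a, massOf μ X a = 1 := by
  have h := sum_measureReal_inter_preimage (μ := μ) hX Set.univ
  simpa [massOf, Measure.real] using h

lemma massOf_cond {S T : Type*} [MeasurableSpace T] [MeasurableSingletonClass T]
    (X : Ω → S) {Y : Ω → T} (hY : Measurable Y) (a : S) (b : T) :
    massOf (μ[|Y ⁻¹' {b}]) X a = (massOf μ Y b)⁻¹ * μ.real (Y ⁻¹' {b} ∩ X ⁻¹' {a}) := by
  rw [massOf, cond_apply (hY (measurableSet_singleton b)), ENNReal.toReal_mul, ENNReal.toReal_inv]
  rfl

lemma sum_massOf_cond_eq_one [IsFiniteMeasure μ] {S T : Type*} [Fintype S]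
    [MeasurableSpace S] [MeasurableSingletonClass S] {X : Ω → S} (hX : Measurable X)
    {Y : Ω → T} {b : T} (hb : massOf μ Y b ≠ 0) : ∑ a, massOf (μ[|Y ⁻¹' {b}]) X a = 1 := by
  have : IsProbabilityMeasure (μ[|Y ⁻¹' {b}]) :=
    cond_isProbabilityMeasure fun h => hb (by simp [massOf, h])
  exact sum_massOf_eq_one hX

/-- The normalized entropy gap is the average of the gaps of the conditional laws. -/
lemma one_sub_nCondEntropy {S T : Type*} [Fintype S] [Fintype T] (X : Ω → S) (Y : Ω → T)
    (hS : 1 < Fintype.card S) (hsum : ∑ b, massOf μ Y b = 1) :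
    1 - nCondEntropy μ X Y = (∑ b, massOf μ Y b *
      uniformGap fun a => massOf (μ[|Y ⁻¹' {b}]) X a) / Real.log (Fintype.card S) := by
  have hlog : Real.log (Fintype.card S) ≠ 0 :=
    (Real.log_pos (by exact_mod_cast hS)).ne'
  have hlog2 : Real.log 2 ≠ 0 := (Real.log_pos one_lt_two).ne'
  simp only [nCondEntropy, condEntropy, entropy, uniformGap, mul_sub, Finset.sum_sub_distrib,
    ← Finset.sum_mul, hsum, Real.logb, ← mul_div_assoc, ← Finset.sum_div]
  field_simp

lemma ProbabilityTheory.IndepFun.massOf_prodMk {S₁ S₂ T₁ T₂ : Type*}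
    [MeasurableSpace S₁] [MeasurableSpace S₂]
    [MeasurableSpace T₁] [MeasurableSingletonClass T₁]
    [MeasurableSpace T₂] [MeasurableSingletonClass T₂]
    {X₁ : Ω → S₁} {X₂ : Ω → S₂} {A₁ : Ω → T₁} {A₂ : Ω → T₂}
    (h : IndepFun (fun ω => (X₁ ω, A₁ ω)) (fun ω => (X₂ ω, A₂ ω)) μ) (b : T₁ × T₂) :
    massOf μ (fun ω => (A₁ ω, A₂ ω)) b = massOf μ A₁ b.1 * massOf μ A₂ b.2 := by
  have hA : IndepFun A₁ A₂ μ := h.comp measurable_snd measurable_snd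
  have hm := hA.measure_inter_preimage_eq_mul {b.1} {b.2} (measurableSet_singleton _)
    (measurableSet_singleton _)
  rw [massOf, massOf, massOf, ← ENNReal.toReal_mul, ← hm]
  congr 2
  ext ω
  simp [Prod.ext_iff]

lemma ProbabilityTheory.IndepFun.massOf_cond_add [IsFiniteMeasure μ] {G T₁ T₂ : Type*}
    [AddCommGroup G] [Fintype G] [MeasurableSpace G] [MeasurableSingletonClass G]
    [MeasurableSpace T₁] [MeasurableSingletonClass T₁]
    [MeasurableSpace T₂] [MeasurableSingletonClass T₂]
    {X₁ X₂ : Ω → G} {A₁ : Ω → T₁} {A₂ : Ω → T₂}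
    (hX₁ : Measurable X₁) (hA₁ : Measurable A₁) (hA₂ : Measurable A₂)
    (h : IndepFun (fun ω => (X₁ ω, A₁ ω)) (fun ω => (X₂ ω, A₂ ω)) μ) (b : T₁ × T₂) (z : G) :
    massOf (μ[|(fun ω => (A₁ ω, A₂ ω)) ⁻¹' {b}]) (fun ω => X₁ ω + X₂ ω) z =
      ∑ x, massOf (μ[|A₁ ⁻¹' {b.1}]) X₁ x * massOf (μ[|A₂ ⁻¹' {b.2}]) X₂ (z - x) := by
  rw [massOf_cond _ (hA₁.prodMk hA₂), h.massOf_prodMk, ← sum_measureReal_inter_preimage hX₁,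
    Finset.mul_sum]
  refine Finset.sum_congr rfl fun x _ => ?_
  have hm := h.measure_inter_preimage_eq_mul {(x, b.1)} {(z - x, b.2)}
    (measurableSet_singleton _) (measurableSet_singleton _)
  have h1 : (fun ω => (X₁ ω, A₁ ω)) ⁻¹' {(x, b.1)} = A₁ ⁻¹' {b.1} ∩ X₁ ⁻¹' {x} := by
    ext ω
    simp [and_comm]
  have h2 : (fun ω => (X₂ ω, A₂ ω)) ⁻¹' {(z - x, b.2)} = A₂ ⁻¹' {b.2} ∩ X₂ ⁻¹' {z - x} := by
    ext ω
    simp [and_comm]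
  have h3 : (fun ω => (A₁ ω, A₂ ω)) ⁻¹' {b} ∩ (fun ω => X₁ ω + X₂ ω) ⁻¹' {z} ∩ X₁ ⁻¹' {x} =
      (A₁ ⁻¹' {b.1} ∩ X₁ ⁻¹' {x}) ∩ (A₂ ⁻¹' {b.2} ∩ X₂ ⁻¹' {z - x}) := by
    ext ω
    simp only [Set.mem_inter_iff, Set.mem_preimage, Set.mem_singleton_iff, Prod.ext_iff,
      eq_sub_iff_add_eq']
    constructor
    · rintro ⟨⟨⟨ha, hb⟩, hz⟩, rfl⟩
      exact ⟨⟨ha, rfl⟩, hb, hz⟩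
    · rintro ⟨⟨ha, rfl⟩, hb, hz⟩
      exact ⟨⟨⟨ha, hb⟩, hz⟩, rfl⟩
  rw [h1, h2] at hm
  rw [h3, massOf_cond _ hA₁, massOf_cond _ hA₂, Measure.real, hm, ENNReal.toReal_mul, mul_inv]
  simp only [Measure.real]
  ring

end Mass

/-- **Lemma (suction at the upper end, conditional multiplicative version).** There are
absolute constants `C < ∞` and `d ∈ ℕ` such that for every finite field `F_q`, whenever the
pairs `(X₁, A₁)` and `(X₂, A₂)` are independent of each other (`X₁, X₂ ∈ F_q`),
`1 − H̄(X₁+X₂ | A₁, A₂) ≤ C · q^d · (1 − H̄(X₁|A₁)) · (1 − H̄(X₂|A₂))`. -/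
theorem cond_entropy_gap_of_sum_le :
    ∃ (C : ℝ) (d : ℕ), 0 < C ∧
      ∀ (F : Type) [Field F] [Fintype F] [MeasurableSpace F] [MeasurableSingletonClass F]
        (Ω : Type) [MeasurableSpace Ω] (μ : Measure Ω) [IsProbabilityMeasure μ]
        (T₁ T₂ : Type) [Fintype T₁] [Fintype T₂]
        [MeasurableSpace T₁] [MeasurableSingletonClass T₁]
        [MeasurableSpace T₂] [MeasurableSingletonClass T₂]
        (X₁ X₂ : Ω → F) (A₁ : Ω → T₁) (A₂ : Ω → T₂),
        Measurable X₁ → Measurable X₂ → Measurable A₁ → Measurable A₂ →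
        IndepFun (fun ω => (X₁ ω, A₁ ω)) (fun ω => (X₂ ω, A₂ ω)) μ →
        1 - nCondEntropy μ (fun ω => X₁ ω + X₂ ω) (fun ω => (A₁ ω, A₂ ω)) ≤
          C * (Fintype.card F : ℝ) ^ d *
            (1 - nCondEntropy μ X₁ A₁) * (1 - nCondEntropy μ X₂ A₂) := by
  refine ⟨16, 3, by norm_num, ?_⟩
  intro F _ _ _ _ Ω _ μ _ T₁ T₂ _ _ _ _ _ _ X₁ X₂ A₁ A₂ hX₁ hX₂ hA₁ hA₂ hind
  have hcard : 1 < Fintype.card F := Fintype.one_lt_card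
  have hlog : 0 < Real.log (Fintype.card F) := Real.log_pos (by exact_mod_cast hcard)
  have hlog_le : Real.log (Fintype.card F) ≤ Fintype.card F :=
    Real.log_le_self (by positivity)
  rw [one_sub_nCondEntropy _ _ hcard (sum_massOf_eq_one (hA₁.prodMk hA₂)),
    one_sub_nCondEntropy _ _ hcard (sum_massOf_eq_one hA₁),
    one_sub_nCondEntropy _ _ hcard (sum_massOf_eq_one hA₂)]
  set g₁ : T₁ → ℝ := fun b => massOf μ A₁ b *
    uniformGap fun a => massOf (μ[|A₁ ⁻¹' {b}]) X₁ a with hg₁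
  set g₂ : T₂ → ℝ := fun b => massOf μ A₂ b *
    uniformGap fun a => massOf (μ[|A₂ ⁻¹' {b}]) X₂ a with hg₂
  set q : ℝ := (Fintype.card F : ℝ) with hq
  have hpair : ∀ b : T₁ × T₂, massOf μ (fun ω => (A₁ ω, A₂ ω)) b *
      (uniformGap fun a => massOf (μ[|(fun ω => (A₁ ω, A₂ ω)) ⁻¹' {b}])
        (fun ω => X₁ ω + X₂ ω) a) ≤ 16 * q ^ 2 * (g₁ b.1 * g₂ b.2) := by
    intro b
    simp_rw [hind.massOf_cond_add hX₁ hA₁ hA₂ b, hind.massOf_prodMk b, hg₁, hg₂]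
    by_cases h₁ : massOf μ A₁ b.1 = 0
    · simp [h₁]
    by_cases h₂ : massOf μ A₂ b.2 = 0
    · simp [h₂]
    have h := uniformGap_convolution_le
      (fun a => massOf_nonneg (μ := μ[|A₁ ⁻¹' {b.1}]) X₁ a) (sum_massOf_cond_eq_one hX₁ h₁)
      (fun a => massOf_nonneg (μ := μ[|A₂ ⁻¹' {b.2}]) X₂ a) (sum_massOf_cond_eq_one hX₂ h₂)
    refine (mul_le_mul_of_nonneg_left h
      (mul_nonneg (massOf_nonneg A₁ b.1) (massOf_nonneg A₂ b.2))).trans_eq ?_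
    ring
  have hg₁_nonneg : ∀ b, 0 ≤ g₁ b := fun b => by
    by_cases h : massOf μ A₁ b = 0
    · simp [hg₁, h]
    · exact mul_nonneg (massOf_nonneg _ _)
        (uniformGap_nonneg (fun a => massOf_nonneg _ _) (sum_massOf_cond_eq_one hX₁ h))
  have hg₂_nonneg : ∀ b, 0 ≤ g₂ b := fun b => by
    by_cases h : massOf μ A₂ b = 0
    · simp [hg₂, h]
    · exact mul_nonneg (massOf_nonneg _ _)
        (uniformGap_nonneg (fun a => massOf_nonneg _ _) (sum_massOf_cond_eq_one hX₂ h))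
  have hsum₁ : 0 ≤ ∑ b, g₁ b := Finset.sum_nonneg fun b _ => hg₁_nonneg b
  have hsum₂ : 0 ≤ ∑ b, g₂ b := Finset.sum_nonneg fun b _ => hg₂_nonneg b
  have hsum := Finset.sum_le_sum fun b (_ : b ∈ Finset.univ) => hpair b
  rw [← Finset.mul_sum, Fintype.sum_prod_type' (fun a b => g₁ a * g₂ b),
    ← Finset.sum_mul_sum] at hsum
  calc _ ≤ 16 * q ^ 2 * ((∑ b, g₁ b) * ∑ b, g₂ b) / Real.log q := by gcongr
    _ = 16 * q ^ 2 * Real.log q * ((∑ b, g₁ b) / Real.log q) * ((∑ b, g₂ b) / Real.log q) := by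
        field_simp
    _ ≤ 16 * q ^ 2 * q * ((∑ b, g₁ b) / Real.log q) * ((∑ b, g₂ b) / Real.log q) := by
        gcongr
    _ = _ := by ring
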